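/- Let $\theta \in [1/2, 1]$, $\delta t > 0$, $\alpha > 0$, $\beta > 0$, and $\lambda \le 0$ be real numbers. Then $1 - (\theta\,\delta t\,\alpha + \beta)\,\lambda \ge 1 > 0$ and $\left| 1 + \big((1-\theta)\,\delta t\,\alpha - \beta\big)\,\lambda \right| \le 1 - (\theta\,\delta t\,\alpha + \beta)\,\lambda$; equivalently, $\left| \dfrac{1 + ((1-\theta)\,\delta t\,\alpha - \beta)\,\lambda}{1 - (\theta\,\delta t\,\alpha + \beta)\,\lambda} \right| \le 1$. -/

import Mathlib

/-- Unconditional stability of the θ-weighted scheme for the pseudo-parabolic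
equation: for `θ ∈ [1/2, 1]`, `δt > 0`, `α, β > 0` and `λ ≤ 0`, one has
`1 - (θ δt α + β) λ ≥ 1 > 0` and
`|1 + ((1-θ) δt α - β) λ| ≤ 1 - (θ δt α + β) λ`. -/
theorem pseudo_parabolic_theta_scheme_stable
    (θ δt α β lam : ℝ) (hθ : θ ∈ Set.Icc (1/2 : ℝ) 1)
    (hδt : 0 < δt) (hα : 0 < α) (hβ : 0 < β) (hlam : lam ≤ 0) :
    (1 : ℝ) ≤ 1 - (θ * δt * α + β) * lam ∧
    (0 : ℝ) < 1 - (θ * δt * α + β) * lam ∧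
    |1 + ((1 - θ) * δt * α - β) * lam| ≤ 1 - (θ * δt * α + β) * lam ∧
    |(1 + ((1 - θ) * δt * α - β) * lam) / (1 - (θ * δt * α + β) * lam)| ≤ 1 := by
  obtain ⟨hθ₁, -⟩ := hθ
  have hs : 0 < δt * α := mul_pos hδt hα
  have hsl : δt * α * lam ≤ 0 := mul_nonpos_of_nonneg_of_nonpos hs.le hlam
  have hβl : β * lam ≤ 0 := mul_nonpos_of_nonneg_of_nonpos hβ.le hlam
  have hθl : (2 * θ - 1) * (δt * α * lam) ≤ 0 :=
    mul_nonpos_of_nonneg_of_nonpos (by linarith) hsl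
  have hone : 1 ≤ 1 - (θ * δt * α + β) * lam := by linarith
  have hpos : 0 < 1 - (θ * δt * α + β) * lam := by linarith
  have habs : |1 + ((1 - θ) * δt * α - β) * lam| ≤ 1 - (θ * δt * α + β) * lam :=
    abs_le.mpr ⟨by linarith, by linarith⟩
  refine ⟨hone, hpos, habs, ?_⟩
  rwa [abs_div, abs_of_pos hpos, div_le_one hpos]
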